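/- Let E be any binary cyclic code of length n and let w ∈ F₂ⁿ. For every integer α with −a_l ≤ α ≤ a_r, the F₂-linear span, inside F₂^N ⊕ F₂ (a Z-part with sign bit), of the set { (M_α(c), c·O(w,−α)) : c ∈ E } ∪ { (r, 0) : r ∈ R } equals the span of { (M_0(c), c·w) : c ∈ E } ∪ { (r, 0) : r ∈ R }. -/

import Mathlib

open Polynomial

abbrev F2 := ZMod 2

abbrev Vec (n : ℕ) := ZMod n → F2

/-- Standard dot product on `F₂`-vectors indexed by a finite type. -/
def dot {ι : Type} [Fintype ι] (u v : ι → F2) : F2 := ∑ i, u i * v i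

/-- Right cyclic shift by `α` positions (indices mod `n`). -/
def shiftR {n : ℕ} (c : Vec n) (α : ℤ) : Vec n := fun i => c (i - (α : ZMod n))

/-- Vectorization of a polynomial: `c₀+c₁x+⋯ ↦ (c₀,c₁,…,c_{n-1})`. -/
def polyVec {n : ℕ} (f : Polynomial F2) : Vec n := fun i => f.coeff i.val

/-- A binary cyclic code: a subspace of `F₂ⁿ` closed under cyclic shift. -/
def IsCyclicCode {n : ℕ} (C : Submodule F2 (Vec n)) : Prop :=
  ∀ c ∈ C, shiftR c 1 ∈ C

/-- Dual code with respect to the standard dot product. -/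
def dualCode {ι : Type} [Fintype ι] (C : Submodule F2 (ι → F2)) :
    Submodule F2 (ι → F2) where
  carrier := {w | ∀ c ∈ C, dot c w = 0}
  add_mem' := by
    intro a b ha hb c hc
    have h1 := ha c hc
    have h2 := hb c hc
    simp only [dot, Set.mem_setOf_eq, Pi.add_apply, mul_add, Finset.sum_add_distrib] at *
    rw [h1, h2, add_zero]
  zero_mem' := by
    intro c hc
    simp [dot]
  smul_mem' := by
    intro r a ha c hc
    have h := ha c hc
    simp only [dot, Set.mem_setOf_eq, Pi.smul_apply, smul_eq_mul] at *
    calc (∑ i, c i * (r * a i)) = r * ∑ i, c i * a i := by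
          rw [Finset.mul_sum]
          exact Finset.sum_congr rfl fun i _ => by ring
      _ = 0 := by rw [h, mul_zero]

/-- `g` is the generator polynomial of the cyclic code `C`: monic, divides `xⁿ−1`,
and `C` consists exactly of the vectorizations of the multiples `f·g` with
`deg f < n − deg g`. -/
structure IsGenPoly {n : ℕ} [NeZero n] (C : Submodule F2 (Vec n)) (g : Polynomial F2) :
    Prop where
  monic : g.Monic
  dvd : g ∣ (X ^ n - 1)
  mem_iff : ∀ v : Vec n, v ∈ C ↔
    ∃ f : Polynomial F2, f.degree < ((n - g.natDegree : ℕ) : WithBot ℕ) ∧ v = polyVec (f * g)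

/-- `L_α(c)`: the length-`N` vector `(last aₗ+α coords of c | c | first aᵣ−α coords of c)`;
uniformly, position `i` holds `c((i − (aₗ+α)) mod n)`. -/
def padL (al n ar : ℕ) (α : ℤ) (c : Vec n) : Fin (al + n + ar) → F2 :=
  fun i => c (((((i : ℕ) : ℤ) - ((al : ℤ) + α)) : ℤ) : ZMod n)

/-- `M_α(c)`: the length-`N` vector `(0^{aₗ+α} | c | 0^{aᵣ−α})`. -/
def padM (al n ar : ℕ) (α : ℤ) (c : Vec n) : Fin (al + n + ar) → F2 :=
  fun i => if (al : ℤ) + α ≤ ((i : ℕ) : ℤ) ∧ ((i : ℕ) : ℤ) < (al : ℤ) + α + n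
    then c (((((i : ℕ) : ℤ) - ((al : ℤ) + α)) : ℤ) : ZMod n) else 0

/-- The set `R` of ancilla stabilizer vectors (1-indexed in the paper):
`e_i + e_{n+i}` for `1 ≤ i ≤ aₗ` and `e_{aₗ+i} + e_{aₗ+n+i}` for `1 ≤ i ≤ aᵣ`. -/
def ancSet (al n ar : ℕ) : Set (Fin (al + n + ar) → F2) :=
  (Set.range fun i : Fin al => (fun k : Fin (al + n + ar) =>
      (if (k : ℕ) = (i : ℕ) then (1 : F2) else 0) +
      (if (k : ℕ) = n + (i : ℕ) then (1 : F2) else 0))) ∪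
  (Set.range fun i : Fin ar => (fun k : Fin (al + n + ar) =>
      (if (k : ℕ) = al + (i : ℕ) then (1 : F2) else 0) +
      (if (k : ℕ) = al + n + (i : ℕ) then (1 : F2) else 0)))

/-- The vector `e_k + e_{n+k}` of length `N` (indices starting at `0`). -/
def ancVec (n N k : ℕ) : Fin N → F2 := fun i =>
  (if (i : ℕ) = k then (1 : F2) else 0) + (if (i : ℕ) = n + k then (1 : F2) else 0)

theorem ancVec_mem_ancSet {al n ar k : ℕ} (hk : k < al + ar) :
    ancVec n (al + n + ar) k ∈ ancSet al n ar := by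
  rcases lt_or_ge k al with h | h
  · exact Or.inl ⟨⟨k, h⟩, rfl⟩
  · refine Or.inr ⟨⟨k - al, by omega⟩, funext fun i => ?_⟩
    have h₁ : al + (k - al) = k := by omega
    have h₂ : al + n + (k - al) = n + k := by omega
    simp only [ancVec, h₁, h₂]

theorem shiftR_shiftR {n : ℕ} (c : Vec n) (a b : ℤ) :
    shiftR (shiftR c a) b = shiftR c (a + b) := by
  funext i
  simp only [shiftR, Int.cast_add]
  congr 1
  ring

theorem shiftR_zero {n : ℕ} (c : Vec n) : shiftR c 0 = c := by
  funext i
  simp [shiftR]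

theorem IsCyclicCode.shiftR_natCast_mem {n : ℕ} {E : Submodule F2 (Vec n)}
    (hE : IsCyclicCode E) {c : Vec n} (hc : c ∈ E) (k : ℕ) : shiftR c (k : ℤ) ∈ E := by
  induction k with
  | zero => simpa [shiftR_zero] using hc
  | succ k ih =>
    have h := hE _ ih
    rw [shiftR_shiftR] at h
    exact_mod_cast h

theorem IsCyclicCode.shiftR_neg_one_mem {n : ℕ} [NeZero n] {E : Submodule F2 (Vec n)}
    (hE : IsCyclicCode E) {c : Vec n} (hc : c ∈ E) : shiftR c (-1) ∈ E := by
  have h := hE.shiftR_natCast_mem hc (n - 1)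
  have hn : 1 ≤ n := NeZero.one_le
  have heq : shiftR c ((n - 1 : ℕ) : ℤ) = shiftR c (-1) := by
    funext i
    simp [shiftR, Nat.cast_sub hn]
  rwa [heq] at h

/-- The dot product is invariant under simultaneous cyclic shift. -/
theorem dot_shiftR_shiftR {n : ℕ} [NeZero n] (c w : Vec n) (a : ℤ) :
    dot (shiftR c a) (shiftR w a) = dot c w :=
  (Equiv.subRight (a : ZMod n)).sum_comp fun i => c i * w i

/-- Moving the window one step to the right amounts to a cyclic shift, up to an ancilla vector. -/
theorem padM_succ_eq (al n ar : ℕ) [NeZero n] {β : ℤ} {k : ℕ} (hk : (k : ℤ) = al + β)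
    (c : Vec n) :
    padM al n ar (β + 1) c =
      padM al n ar β (shiftR c 1) + c (-1) • ancVec n (al + n + ar) k := by
  funext i
  have hn : 0 < n := NeZero.pos n
  have harg : ((((i : ℕ) : ℤ) - ((al : ℤ) + β) : ℤ) : ZMod n) - ((1 : ℤ) : ZMod n) =
      ((((i : ℕ) : ℤ) - ((al : ℤ) + (β + 1)) : ℤ) : ZMod n) := by
    push_cast
    ring
  simp only [padM, shiftR, ancVec, Pi.add_apply, Pi.smul_apply, smul_eq_mul, harg]
  by_cases h₁ : (i : ℕ) = k
  · have hv : ((((i : ℕ) : ℤ) - ((al : ℤ) + (β + 1)) : ℤ) : ZMod n) = -1 := by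
      rw [show (((i : ℕ) : ℤ) - ((al : ℤ) + (β + 1)) : ℤ) = -1 by omega]
      simp
    rw [hv, if_neg (by omega), if_pos (by omega), if_pos h₁, if_neg (by omega), add_zero,
      mul_one, CharTwo.add_self_eq_zero]
  · by_cases h₂ : (i : ℕ) = n + k
    · have hv : ((((i : ℕ) : ℤ) - ((al : ℤ) + (β + 1)) : ℤ) : ZMod n) = -1 := by
        rw [show (((i : ℕ) : ℤ) - ((al : ℤ) + (β + 1)) : ℤ) = (n : ℤ) - 1 by omega]
        simp
      rw [hv, if_pos (by omega), if_neg (by omega), if_neg h₁, if_pos h₂]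
      simp
    · rw [if_neg h₁, if_neg h₂, add_zero, mul_zero, add_zero]
      exact if_congr (by omega) rfl rfl

/-- The signed span of the code placed at offset `α`, together with the ancilla vectors. -/
def signedSpan {n : ℕ} [NeZero n] (E : Submodule F2 (Vec n)) (w : Vec n) (al ar : ℕ) (α : ℤ) :
    Submodule F2 ((Fin (al + n + ar) → F2) × F2) :=
  Submodule.span F2
    ({ x : (Fin (al + n + ar) → F2) × F2 |
        ∃ c ∈ E, x = (padM al n ar α c, dot c (shiftR w (-α))) } ∪
      { x : (Fin (al + n + ar) → F2) × F2 | ∃ r ∈ ancSet al n ar, x = (r, 0) })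

section signedSpan

variable {n : ℕ} [NeZero n] {E : Submodule F2 (Vec n)} {w : Vec n} {al ar : ℕ}

theorem padM_mem_signedSpan (α : ℤ) {c : Vec n} (hc : c ∈ E) :
    (padM al n ar α c, dot c (shiftR w (-α))) ∈ signedSpan E w al ar α :=
  Submodule.subset_span (Or.inl ⟨c, hc, rfl⟩)

theorem anc_mem_signedSpan (α : ℤ) {r : Fin (al + n + ar) → F2} (hr : r ∈ ancSet al n ar) :
    (r, 0) ∈ signedSpan E w al ar α :=
  Submodule.subset_span (Or.inr ⟨r, hr, rfl⟩)

theorem signedSpan_succ (hE : IsCyclicCode E) {β : ℤ} (h₁ : -(al : ℤ) ≤ β)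
    (h₂ : β < (ar : ℤ)) : signedSpan E w al ar (β + 1) = signedSpan E w al ar β := by
  obtain ⟨k, hk⟩ : ∃ k : ℕ, (k : ℤ) = al + β := ⟨(al + β).toNat, by omega⟩
  have hanc : ancVec n (al + n + ar) k ∈ ancSet al n ar := ancVec_mem_ancSet (by omega)
  have key : ∀ c : Vec n, (padM al n ar (β + 1) c, dot c (shiftR w (-(β + 1)))) =
      (padM al n ar β (shiftR c 1), dot (shiftR c 1) (shiftR w (-β))) +
        c (-1) • (ancVec n (al + n + ar) k, (0 : F2)) := by
    intro c
    have hw : shiftR w (-β) = shiftR (shiftR w (-(β + 1))) 1 := by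
      rw [shiftR_shiftR]
      congr 1
      ring
    rw [padM_succ_eq al n ar hk c, hw, dot_shiftR_shiftR]
    simp
  apply le_antisymm
  · refine Submodule.span_le.2 ?_
    rintro x (⟨c, hc, rfl⟩ | ⟨r, hr, rfl⟩)
    · rw [SetLike.mem_coe, key]
      exact add_mem (padM_mem_signedSpan β (hE c hc))
        (Submodule.smul_mem _ _ (anc_mem_signedSpan β hanc))
    · exact anc_mem_signedSpan β hr
  · refine Submodule.span_le.2 ?_
    rintro x (⟨c, hc, rfl⟩ | ⟨r, hr, rfl⟩)
    · have hc' := hE.shiftR_neg_one_mem hc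
      have h := key (shiftR c (-1))
      rw [shiftR_shiftR, neg_add_cancel, shiftR_zero] at h
      rw [SetLike.mem_coe, eq_sub_of_add_eq h.symm]
      exact sub_mem (padM_mem_signedSpan (β + 1) hc')
        (Submodule.smul_mem _ _ (anc_mem_signedSpan (β + 1) hanc))
    · exact anc_mem_signedSpan (β + 1) hr

theorem signedSpan_eq_neg (hE : IsCyclicCode E) {β : ℤ} (h₁ : -(al : ℤ) ≤ β)
    (h₂ : β ≤ (ar : ℤ)) : signedSpan E w al ar β = signedSpan E w al ar (-(al : ℤ)) := by
  induction β, h₁ using Int.leInduction with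
  | base => rfl
  | succ β h ih => rw [signedSpan_succ hE h (by omega), ih (by omega)]

end signedSpan

/-- For any binary cyclic code `E` and `w ∈ F₂ⁿ`, for every
`α ∈ [−aₗ, aᵣ]` the span (inside `F₂^N ⊕ F₂`, a Z-part with sign bit) of
`{(M_α(c), c·O(w,−α)) : c ∈ E} ∪ {(r,0) : r ∈ R}` equals the span of
`{(M_0(c), c·w) : c ∈ E} ∪ {(r,0) : r ∈ R}`. -/
theorem stmt11 (n : ℕ) [NeZero n] (E : Submodule F2 (Vec n)) (hE : IsCyclicCode E)
    (w : Vec n) (al ar : ℕ)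
    (α : ℤ) (hα₁ : -(al : ℤ) ≤ α) (hα₂ : α ≤ (ar : ℤ)) :
    Submodule.span F2
      ({ x : (Fin (al + n + ar) → F2) × F2 |
          ∃ c ∈ E, x = (padM al n ar α c, dot c (shiftR w (-α))) } ∪
        { x : (Fin (al + n + ar) → F2) × F2 | ∃ r ∈ ancSet al n ar, x = (r, 0) })
    = Submodule.span F2
      ({ x : (Fin (al + n + ar) → F2) × F2 | ∃ c ∈ E, x = (padM al n ar 0 c, dot c w) } ∪
        { x : (Fin (al + n + ar) → F2) × F2 | ∃ r ∈ ancSet al n ar, x = (r, 0) }) := by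
  have h := (signedSpan_eq_neg (w := w) hE hα₁ hα₂).trans
    (signedSpan_eq_neg (β := 0) hE (by omega) (by omega)).symm
  simpa only [signedSpan, neg_zero, shiftR_zero] using h
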